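/- arXiv:2605.05523 — 6 statements merged into one kernel-verified Lean document; each statement's English description precedes it below -/
import Mathlib

section
/- Let K ⊂ ℝ be a compact set, let m ≥ 1, k₂ ≥ 1, and let g : K^m → ℝ^{k₂} be a continuous function that is permutation invariant, i.e. g(x_{σ(1)}, …, x_{σ(m)}) = g(x_1, …, x_m) for every bijection σ of {1, …, m} and every (x_1, …, x_m) ∈ K^m. Define φ : ℝ → ℝ^{m+1} by φ(t) = (1, t, t², …, t^m) and E : K^m → ℝ^{m+1} by E(x) = ∑_{i=1}^m φ(x_i). Then there exists a function ρ : E(K^m) → ℝ^{k₂}, continuous on the (compact) image E(K^m), such that g(x) = ρ(∑_{i=1}^m φ(x_i)) for all x ∈ K^m. -/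
theorem ds_esymm_eq {m : ℕ} (x y : Fin m → ℝ)
    (h : ∀ j ≤ m, ∑ i, x i ^ j = ∑ i, y i ^ j) (k : ℕ) (hk : k ≤ m) :
    MvPolynomial.aeval x (MvPolynomial.esymm (Fin m) ℝ k) =
      MvPolynomial.aeval y (MvPolynomial.esymm (Fin m) ℝ k) := by
  induction k using Nat.strong_induction_on with
  | _ k ih =>
    rcases Nat.eq_zero_or_pos k with rfl | hpos
    · simp
    have hx := congrArg (MvPolynomial.aeval x) (MvPolynomial.mul_esymm_eq_sum (Fin m) ℝ k)
    have hy := congrArg (MvPolynomial.aeval y) (MvPolynomial.mul_esymm_eq_sum (Fin m) ℝ k)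
    simp only [map_mul, map_sum, map_pow, map_neg, map_one, map_natCast, MvPolynomial.psum,
      MvPolynomial.aeval_X] at hx hy
    have hk0 : (k : ℝ) ≠ 0 := by exact_mod_cast hpos.ne'
    apply mul_left_cancel₀ hk0
    rw [hx, hy]
    congr 1
    apply Finset.sum_congr rfl
    intro a ha
    rw [Finset.mem_filter, Finset.HasAntidiagonal.mem_antidiagonal] at ha
    rw [ih a.1 ha.2 (by omega), h a.2 (by omega)]

theorem ds_multiset_eq {m : ℕ} (x y : Fin m → ℝ)
    (h : ∀ j ≤ m, ∑ i, x i ^ j = ∑ i, y i ^ j) :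
    (Finset.univ.val.map x : Multiset ℝ) = Finset.univ.val.map y := by
  rw [← Polynomial.roots_multiset_prod_X_sub_C (Finset.univ.val.map x),
    ← Polynomial.roots_multiset_prod_X_sub_C (Finset.univ.val.map y),
    Multiset.prod_X_sub_X_eq_sum_esymm, Multiset.prod_X_sub_X_eq_sum_esymm]
  congr 1
  simp only [Multiset.card_map, Finset.card_val, Finset.card_univ, Fintype.card_fin]
  apply Finset.sum_congr rfl
  intro j hj
  have := ds_esymm_eq x y h j (by simpa [Nat.lt_succ_iff] using hj)
  rw [MvPolynomial.aeval_esymm_eq_multiset_esymm,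
    MvPolynomial.aeval_esymm_eq_multiset_esymm] at this
  rw [this]

theorem ds_sort_eq {m : ℕ} (x y : Fin m → ℝ)
    (h : ∀ j ≤ m, ∑ i, x i ^ j = ∑ i, y i ^ j) :
    x ∘ Tuple.sort x = y ∘ Tuple.sort y := by
  apply List.ofFn_injective
  have hp : (List.ofFn x).Perm (List.ofFn y) := by
    have := ds_multiset_eq x y h
    rw [Fin.univ_val_map, Fin.univ_val_map] at this
    exact Multiset.coe_eq_coe.1 this
  exact List.Perm.eq_of_sortedLE (Tuple.monotone_sort x).sortedLE_ofFn
    (Tuple.monotone_sort y).sortedLE_ofFn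
    (((Equiv.Perm.ofFn_comp_perm _ x).trans hp).trans (Equiv.Perm.ofFn_comp_perm _ y).symm)


/-- exact Deep Sets representation for continuous permutation-invariant
vector-valued functions with one-dimensional inputs, via the power-sum embedding
`E x = (∑ xᵢ⁰, ∑ xᵢ¹, …, ∑ xᵢᵐ)`. -/
theorem deepsets_exact_representation_one_dim
    (K : Set ℝ) (hK : IsCompact K)
    (m k₂ : ℕ) (hm : 1 ≤ m) (hk₂ : 1 ≤ k₂)
    (g : (Fin m → ℝ) → (Fin k₂ → ℝ))
    (hg : ContinuousOn g {x | ∀ i, x i ∈ K})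
    (hinv : ∀ σ : Equiv.Perm (Fin m), ∀ x : Fin m → ℝ,
      (∀ i, x i ∈ K) → g (x ∘ σ) = g x) :
    ∃ ρ : (Fin (m + 1) → ℝ) → (Fin k₂ → ℝ),
      ContinuousOn ρ
        ((fun x : Fin m → ℝ => ∑ i, fun j : Fin (m + 1) => x i ^ (j : ℕ)) ''
          {x | ∀ i, x i ∈ K}) ∧
      ∀ x : Fin m → ℝ, (∀ i, x i ∈ K) →
        g x = ρ (∑ i, fun j : Fin (m + 1) => x i ^ (j : ℕ)) := by
  classical
  set S : Set (Fin m → ℝ) := {x | ∀ i, x i ∈ K} with hS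
  set E : (Fin m → ℝ) → (Fin (m + 1) → ℝ) :=
    fun x => ∑ i, fun j : Fin (m + 1) => x i ^ (j : ℕ) with hE
  have key : ∀ x ∈ S, ∀ y ∈ S, E x = E y → g x = g y := by
    intro x hx y hy hxy
    have h : ∀ j ≤ m, ∑ i, x i ^ j = ∑ i, y i ^ j := by
      intro j hj
      have := congrFun hxy ⟨j, by omega⟩
      simpa [hE, Finset.sum_apply] using this
    rw [← hinv (Tuple.sort x) x hx, ← hinv (Tuple.sort y) y hy, ds_sort_eq x y h]
  have hScomp : IsCompact S := by
    have := isCompact_univ_pi (fun _ : Fin m => hK)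
    convert this using 1
    ext x
    simp [hS]
  have hEc : Continuous E := by
    simp only [hE]
    fun_prop
  let ρ : (Fin (m + 1) → ℝ) → (Fin k₂ → ℝ) := fun z =>
    if hz : ∃ x ∈ S, E x = z then g hz.choose else 0
  have hρ : ∀ x ∈ S, g x = ρ (E x) := by
    intro x hx
    have hz : ∃ x' ∈ S, E x' = E x := ⟨x, hx, rfl⟩
    simp only [ρ, dif_pos hz]
    exact key x hx _ hz.choose_spec.1 hz.choose_spec.2.symm
  refine ⟨ρ, ?_, fun x hx => hρ x hx⟩
  have : CompactSpace S := isCompact_iff_compactSpace.1 hScomp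
  let f : S → E '' S := fun x => ⟨E x, Set.mem_image_of_mem E x.2⟩
  have hf : Continuous f := Continuous.subtype_mk (hEc.comp continuous_subtype_val) _
  have hfs : Function.Surjective f := by
    rintro ⟨_, x, hx, rfl⟩
    exact ⟨⟨x, hx⟩, rfl⟩
  have hq := Topology.IsQuotientMap.of_surjective_continuous hfs hf
  rw [continuousOn_iff_continuous_domRestrict, hq.continuous_iff]
  have : (E '' S).domRestrict ρ ∘ f = S.domRestrict g := by
    funext x
    exact (hρ x x.2).symm
  rw [this]
  exact continuousOn_iff_continuous_domRestrict.1 hg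
end

section
/- Let K ⊂ ℝ^{k₁} be a compact set, let m ≥ 1, k₁ ≥ 1, k₂ ≥ 1, and let g : K^m → ℝ^{k₂} be a continuous function that is permutation invariant, i.e. g(x_{σ(1)}, …, x_{σ(m)}) = g(x_1, …, x_m) for every bijection σ of {1, …, m}. Then for every ε > 0 there exist n ∈ ℕ, a continuous map φ : ℝ^{k₁} → ℝ^n, and a continuous map ρ : ℝ^n → ℝ^{k₂} such that sup over (x_1, …, x_m) ∈ K^m of ‖g(x_1, …, x_m) − ρ(∑_{i=1}^m φ(x_i))‖ < ε. -/
theorem ds_separate {E : Type*} [MetricSpace E] {m : ℕ} (x y : Fin m → E)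
    (h : ∀ f : C(E, ℝ), ∑ i, f (x i) = ∑ i, f (y i)) :
    ∃ σ : Equiv.Perm (Fin m), x = y ∘ σ := by
  classical
  suffices hcard : ∀ a, Fintype.card {i // x i = a} = Fintype.card {i // y i = a} by
    let e : ∀ a, {i // x i = a} ≃ {i // y i = a} := fun a => Fintype.equivOfCardEq (hcard a)
    refine ⟨(Equiv.sigmaFiberEquiv x).symm.trans
      ((Equiv.sigmaCongrRight e).trans (Equiv.sigmaFiberEquiv y)), ?_⟩
    funext i
    exact (e (x i) ⟨i, rfl⟩).2.symm
  intro a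
  let S : Finset E := (Finset.univ.image x ∪ Finset.univ.image y).erase a
  let f : C(E, ℝ) := ⟨fun z => ∏ s ∈ S, dist z s, by fun_prop⟩
  have hfa : f a ≠ 0 := by
    change ∏ s ∈ S, dist a s ≠ 0
    rw [Finset.prod_ne_zero_iff]
    intro s hs
    exact dist_ne_zero.2 (Finset.ne_of_mem_erase hs).symm
  have hf0 : ∀ z ∈ S, f z = 0 := by
    intro z hz
    exact Finset.prod_eq_zero hz (dist_self z)
  have hx : ∀ i, f (x i) = if x i = a then f a else 0 := by
    intro i
    split_ifs with hi
    · rw [hi]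
    · exact hf0 _ (by simp [S, hi])
  have hy : ∀ i, f (y i) = if y i = a then f a else 0 := by
    intro i
    split_ifs with hi
    · rw [hi]
    · exact hf0 _ (by simp [S, hi])
  have := h f
  simp only [hx, hy, ← Finset.sum_filter, Finset.sum_const, nsmul_eq_mul] at this
  have h2 := mul_right_cancel₀ hfa this
  rw [Fintype.card_subtype, Fintype.card_subtype]
  exact_mod_cast h2

/-- Deep Sets universal approximation for continuous permutation-invariant
vector-valued functions on compact `K ⊂ ℝ^{k₁}`. -/
theorem deepsets_universal_approximation
    (k₁ k₂ m : ℕ) (hm : 1 ≤ m) (hk₁ : 1 ≤ k₁) (hk₂ : 1 ≤ k₂)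
    (K : Set (EuclideanSpace ℝ (Fin k₁))) (hK : IsCompact K)
    (g : (Fin m → EuclideanSpace ℝ (Fin k₁)) → EuclideanSpace ℝ (Fin k₂))
    (hg : ContinuousOn g {x | ∀ i, x i ∈ K})
    (hinv : ∀ σ : Equiv.Perm (Fin m), ∀ x : Fin m → EuclideanSpace ℝ (Fin k₁),
      (∀ i, x i ∈ K) → g (x ∘ σ) = g x)
    (ε : ℝ) (hε : 0 < ε) :
    ∃ (n : ℕ) (φ : EuclideanSpace ℝ (Fin k₁) → EuclideanSpace ℝ (Fin n))
      (ρ : EuclideanSpace ℝ (Fin n) → EuclideanSpace ℝ (Fin k₂)),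
      Continuous φ ∧ Continuous ρ ∧
      ∀ x : Fin m → EuclideanSpace ℝ (Fin k₁), (∀ i, x i ∈ K) →
        ‖g x - ρ (∑ i, φ (x i))‖ < ε := by
  classical
  set X : Set (Fin m → EuclideanSpace ℝ (Fin k₁)) := {x | ∀ i, x i ∈ K} with hX
  have hXc : IsCompact X := isCompact_pi_infinite fun _ => hK
  let C : Set ((Fin m → EuclideanSpace ℝ (Fin k₁)) × (Fin m → EuclideanSpace ℝ (Fin k₁))) :=
    (X ×ˢ X) ∩ (fun p => ‖g p.1 - g p.2‖) ⁻¹' Set.Ici ε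
  have hC : IsCompact C := by
    refine (hXc.prod hXc).of_isClosed_subset ?_ Set.inter_subset_left
    refine ContinuousOn.preimage_isClosed_of_isClosed ?_ (hXc.prod hXc).isClosed isClosed_Ici
    exact ((hg.comp continuousOn_fst fun p hp => hp.1).sub
      (hg.comp continuousOn_snd fun p hp => hp.2)).norm
  obtain ⟨t, ht⟩ := hC.elim_finite_subcover
    (fun f : C(EuclideanSpace ℝ (Fin k₁), ℝ) => {p | ∑ i, f (p.1 i) ≠ ∑ i, f (p.2 i)})
    (fun f => isOpen_ne_fun (by fun_prop) (by fun_prop))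
    (by
      rintro ⟨x, y⟩ ⟨⟨hx, hy⟩, hxy⟩
      by_contra hcon
      simp only [Set.mem_iUnion, Set.mem_ofPred_eq, not_exists, not_not] at hcon
      obtain ⟨σ, hσ⟩ := ds_separate x y hcon
      have := hinv σ y hy
      rw [← hσ] at this
      simp only [Set.mem_preimage, this, sub_self, norm_zero, Set.mem_Ici] at hxy
      linarith)
  let φ : EuclideanSpace ℝ (Fin k₁) → EuclideanSpace ℝ (Fin t.card) :=
    fun z => WithLp.toLp 2 fun j => (t.equivFin.symm j).1 z
  have hφ : Continuous φ := by fun_prop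
  let Φ : (Fin m → EuclideanSpace ℝ (Fin k₁)) → EuclideanSpace ℝ (Fin t.card) :=
    fun x => ∑ i, φ (x i)
  have hΦ : Continuous Φ := by fun_prop
  have key : ∀ x ∈ X, ∀ y ∈ X, Φ x = Φ y → ‖g x - g y‖ < ε := by
    intro x hx y hy hxy
    by_contra hcon
    have hmem : (x, y) ∈ C := ⟨⟨hx, hy⟩, not_lt.1 hcon⟩
    obtain ⟨f, hf, hne⟩ := Set.mem_iUnion₂.1 (ht hmem)
    apply hne
    have := congrArg (fun v => v (t.equivFin ⟨f, hf⟩)) hxy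
    simpa [Φ, φ] using this
  obtain ⟨ρ, hρ⟩ := exists_continuous_forall_mem_convex_of_local_const
    (t := fun z : EuclideanSpace ℝ (Fin t.card) =>
      {c : EuclideanSpace ℝ (Fin k₂) | ∀ x ∈ X, Φ x = z → c ∈ Metric.ball (g x) ε})
    (by
      intro z
      have : {c : EuclideanSpace ℝ (Fin k₂) | ∀ x ∈ X, Φ x = z → c ∈ Metric.ball (g x) ε}
        = ⋂ x ∈ X, ⋂ (_ : Φ x = z), Metric.ball (g x) ε := by
        ext c; simp
      rw [this]
      exact convex_iInter fun x => convex_iInter fun _ => convex_iInter fun _ =>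
        convex_ball _ _)
    (by
      intro z
      by_cases hz : ∃ x0 ∈ X, Φ x0 = z
      · obtain ⟨x0, hx0, rfl⟩ := hz
        refine ⟨g x0, ?_⟩
        have hD : IsCompact (X ∩ (fun x => ‖g x0 - g x‖) ⁻¹' Set.Ici ε) := by
          refine hXc.of_isClosed_subset ?_ Set.inter_subset_left
          exact ContinuousOn.preimage_isClosed_of_isClosed
            (continuousOn_const.sub hg).norm hXc.isClosed isClosed_Ici
        have hn : Φ x0 ∉ Φ '' (X ∩ (fun x => ‖g x0 - g x‖) ⁻¹' Set.Ici ε) := by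
          rintro ⟨x, ⟨hx, hx2⟩, he⟩
          exact absurd (key x0 hx0 x hx he.symm) (not_lt.2 hx2)
        filter_upwards [(hD.image hΦ).isClosed.isOpen_compl.mem_nhds hn] with y hy x hx hxy
        rw [mem_ball_iff_norm]
        by_contra hcon
        exact hy ⟨x, ⟨hx, not_lt.1 hcon⟩, hxy⟩
      · refine ⟨0, ?_⟩
        have hn : z ∉ Φ '' X := hz
        filter_upwards [(hXc.image hΦ).isClosed.isOpen_compl.mem_nhds hn] with y hy x hx hxy
        exact absurd ⟨x, hx, hxy⟩ hy)
  refine ⟨t.card, φ, ρ, hφ, ρ.continuous, fun x hx => ?_⟩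
  rw [norm_sub_rev, ← mem_ball_iff_norm]
  exact hρ (Φ x) x hx rfl
end

section
/- Let m ≥ 1 and k ≥ 1, and let p be a real polynomial in the m·k variables X_{i,q} (i = 1, …, m; q = 1, …, k) that is invariant under permutations of the index i, i.e. p((X_{σ(i),q})_{i,q}) = p((X_{i,q})_{i,q}) for every bijection σ of {1, …, m}. Then p can be written as a real polynomial in the power-sum multisymmetric functions p_α(X) = ∑_{i=1}^m ∏_{q=1}^k X_{i,q}^{α_q}, where α ranges over multi-indices in ℕ^k; i.e. p lies in the ℝ-subalgebra of ℝ[X_{i,q}] generated by the p_α. -/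
theorem multisym_aux {R : Type*} [CommRing R] [Algebra ℝ R] (A : Subalgebra ℝ R) (m : ℕ)
    (S : Set (Fin m → R)) (hS : ∀ a ∈ S, ∀ b ∈ S, a * b ∈ S)
    (hA : ∀ a ∈ S, ∑ i, a i ∈ A) (n : ℕ) :
    ∀ g : Fin n → (Fin m → R), (∀ j, g j ∈ S) →
      ∑ f : Fin n ↪ Fin m, ∏ j, g j (f j) ∈ A := by
  classical
  induction n with
  | zero =>
    intro g _
    simp only [Finset.univ_eq_empty, Finset.prod_empty]
    exact A.sum_mem fun _ _ => A.one_mem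
  | succ n ih =>
    intro g hg
    have key : ∑ f : Fin (n+1) ↪ Fin m, ∏ j, g j (f j)
        = (∑ i, g 0 i) * (∑ e : Fin n ↪ Fin m, ∏ j, g j.succ (e j))
          - ∑ l : Fin n, ∑ e : Fin n ↪ Fin m,
            ∏ j, (Function.update (fun j : Fin n => g j.succ) l (g 0 * g l.succ)) j (e j) := by
      rw [← (Equiv.embeddingFinSucc n (Fin m)).symm.sum_comp, Fintype.sum_sigma,
        Finset.sum_comm, Finset.mul_sum, ← Finset.sum_sub_distrib]
      refine Finset.sum_congr rfl fun e _ => ?_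
      have h1 : ∀ i : {i // i ∉ Set.range e},
          ∏ j, g j (((Equiv.embeddingFinSucc n (Fin m)).symm ⟨e, i⟩) j)
            = g 0 i * ∏ j, g j.succ (e j) := by
        intro i
        rw [Fin.prod_univ_succ]
        simp
      have h2 : ∀ l : Fin n,
          ∏ j, (Function.update (fun j : Fin n => g j.succ) l (g 0 * g l.succ)) j (e j)
            = g 0 (e l) * ∏ j, g j.succ (e j) := by
        intro l
        rw [← Finset.mul_prod_erase _ _ (Finset.mem_univ l),
          ← Finset.mul_prod_erase _ (fun j => g j.succ (e j)) (Finset.mem_univ l)]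
        rw [Finset.prod_congr rfl (g := fun j => g j.succ (e j))]
        · simp [mul_assoc]
        · intro j hj
          rw [Function.update_of_ne (Finset.ne_of_mem_erase hj)]
      simp_rw [h1, h2]
      rw [← Finset.sum_mul, ← Finset.sum_mul, ← sub_mul]
      congr 1
      rw [eq_sub_iff_add_eq, ← Fintype.sum_subtype_add_sum_subtype (fun i => i ∈ Set.range e) (g 0),
        add_comm]
      congr 1
      exact Finset.sum_bijective (Equiv.ofInjective e e.injective)
        (Equiv.bijective _) (fun _ => by simp) (fun _ _ => rfl)
    rw [key]
    refine A.sub_mem (A.mul_mem (hA _ (hg 0)) (ih _ fun j => hg _)) (A.sum_mem fun l _ => ih _ ?_)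
    intro j
    by_cases h : j = l
    · subst h
      simpa using hS _ (hg 0) _ (hg _)
    · rw [Function.update_of_ne h]
      exact hg _

/-- every real polynomial in the variables `X (i, q)` that is invariant
under permutations of the index `i` lies in the ℝ-subalgebra generated by the
power-sum multisymmetric polynomials `p_α = ∑ i, ∏ q, X (i, q) ^ α q`. -/
theorem multisymmetric_power_sums_generate
    (m k : ℕ) (hm : 1 ≤ m) (hk : 1 ≤ k)
    (p : MvPolynomial (Fin m × Fin k) ℝ)
    (hp : ∀ σ : Equiv.Perm (Fin m),
      MvPolynomial.rename (fun iq : Fin m × Fin k => (σ iq.1, iq.2)) p = p) :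
    p ∈ Algebra.adjoin ℝ
      (Set.range fun α : Fin k → ℕ =>
        ∑ i : Fin m, ∏ q : Fin k,
          (MvPolynomial.X (i, q) : MvPolynomial (Fin m × Fin k) ℝ) ^ α q) := by
  classical
  set A := Algebra.adjoin ℝ
      (Set.range fun α : Fin k → ℕ =>
        ∑ i : Fin m, ∏ q : Fin k,
          (MvPolynomial.X (i, q) : MvPolynomial (Fin m × Fin k) ℝ) ^ α q) with hAdef
  have main : ∀ r : MvPolynomial (Fin m × Fin k) ℝ,
      ∑ σ : Equiv.Perm (Fin m),
        MvPolynomial.rename (fun iq : Fin m × Fin k => (σ iq.1, iq.2)) r ∈ A := by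
    intro r
    induction r using MvPolynomial.induction_on' with
    | add a b ha hb =>
      simp only [map_add, Finset.sum_add_distrib]
      exact A.add_mem ha hb
    | monomial d c =>
      have h := multisym_aux A m
        (Set.range fun (α : Fin k → ℕ) (i : Fin m) => ∏ q : Fin k,
          (MvPolynomial.X (i, q) : MvPolynomial (Fin m × Fin k) ℝ) ^ α q)
        (by
          rintro _ ⟨a, rfl⟩ _ ⟨b, rfl⟩
          refine ⟨a + b, ?_⟩
          funext i
          simp [pow_add, Finset.prod_mul_distrib])
        (by
          rintro _ ⟨a, rfl⟩
          exact Algebra.subset_adjoin ⟨a, rfl⟩)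
        m
        (fun j i => ∏ q : Fin k,
          (MvPolynomial.X (i, q) : MvPolynomial (Fin m × Fin k) ℝ) ^ d (j, q))
        (fun j => ⟨fun q => d (j, q), rfl⟩)
      rw [← (Equiv.embeddingEquivOfFinite (Fin m)).symm.sum_comp] at h
      convert A.smul_mem h c using 1
      rw [Finset.smul_sum]
      refine Finset.sum_congr rfl fun σ _ => ?_
      rw [MvPolynomial.monomial_eq, map_mul, MvPolynomial.algHom_C, Algebra.smul_def,
        Finsupp.prod_fintype _ _ (by simp), map_prod, Fintype.prod_prod_type]
      simp [Equiv.embeddingEquivOfFinite]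
  have h := main p
  simp only [hp, Finset.sum_const, Finset.card_univ, Fintype.card_perm, Fintype.card_fin] at h
  rw [← Nat.cast_smul_eq_nsmul ℝ] at h
  have h2 := A.smul_mem h ((m.factorial : ℝ)⁻¹)
  rwa [smul_smul, inv_mul_cancel₀ (by exact_mod_cast m.factorial_ne_zero), one_smul] at h2
end

section
/- Let K ⊂ ℝ^{k₁} be compact, m ≥ 1, and let g : K^m → ℝ^m with components g_1, …, g_m be continuous and permutation preserving: g_i(x_{σ(1)}, …, x_{σ(m)}) = g_{σ(i)}(x_1, …, x_m) for every bijection σ of {1, …, m} and all i. Then for every ε > 0 there exist n ∈ ℕ and continuous maps φ : ℝ^{k₁} → ℝ^n, ρ₂ : ℝ^n → ℝ^n, and ρ₁ : ℝ^{k₁} × ℝ^n → ℝ such that for every i = 1, …, m, sup over (x_1, …, x_m) ∈ K^m of |g_i(x_1, …, x_m) − ρ₁(x_i, ρ₂(∑_{j ≠ i} φ(x_j)))| < ε. -/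
/-- Equality of all moments up to degree `2 m` forces the families to agree up to permutation. -/
theorem moments_separate (k m : ℕ) (x y : Fin m → (Fin k → ℝ))
    (h : ∀ a : Fin k → Fin (2 * m + 1),
      ∑ j, ∏ c, x j c ^ (a c : ℕ) = ∑ j, ∏ c, y j c ^ (a c : ℕ)) :
    ∃ σ : Equiv.Perm (Fin m), ∀ i, x (σ i) = y i := by
  classical
  have hp : ∀ p : MvPolynomial (Fin k) ℝ, p.totalDegree ≤ 2 * m →
      ∑ j, MvPolynomial.eval (x j) p = ∑ j, MvPolynomial.eval (y j) p := by
    intro p hdeg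
    simp only [MvPolynomial.eval_eq']
    rw [Finset.sum_comm, Finset.sum_comm (s := Finset.univ)]
    refine Finset.sum_congr rfl fun d hd => ?_
    rw [← Finset.mul_sum, ← Finset.mul_sum]
    congr 1
    have hle : ∀ c, d c < 2 * m + 1 := fun c => by
      have h1 := MvPolynomial.monomial_le_degreeOf c hd
      have h2 := MvPolynomial.degreeOf_le_totalDegree p c
      omega
    exact h fun c => ⟨d c, hle c⟩
  have hcount : ∀ z, Fintype.card {i // y i = z} = Fintype.card {i // x i = z} := by
    intro z
    let T : Finset (Fin k → ℝ) := (Finset.univ.image x ∪ Finset.univ.image y).erase z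
    have hTc : T.card ≤ 2 * m := by
      refine (Finset.card_le_card (Finset.erase_subset _ _)).trans
        ((Finset.card_union_le _ _).trans ?_)
      have h1 := Finset.card_image_le (s := (Finset.univ : Finset (Fin m))) (f := x)
      have h2 := Finset.card_image_le (s := (Finset.univ : Finset (Fin m))) (f := y)
      simp only [Finset.card_univ, Fintype.card_fin] at h1 h2
      omega
    have hex : ∀ w : Fin k → ℝ, ∃ q : MvPolynomial (Fin k) ℝ, q.totalDegree ≤ 1 ∧
        MvPolynomial.eval w q = 0 ∧ (w ≠ z → MvPolynomial.eval z q ≠ 0) := by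
      intro w
      by_cases hw : w = z
      · exact ⟨0, by simp, by simp, fun h => absurd hw h⟩
      · obtain ⟨c, hc⟩ := Function.ne_iff.mp hw
        refine ⟨MvPolynomial.X c - MvPolynomial.C (w c), ?_, by simp, fun _ => ?_⟩
        · exact (MvPolynomial.totalDegree_sub_C_le _ _).trans (by simp)
        · simpa [sub_eq_zero] using fun h => hc h.symm
    choose q hq1 hq2 hq3 using hex
    let p := ∏ w ∈ T, q w
    have hpd : p.totalDegree ≤ 2 * m := by
      refine (MvPolynomial.totalDegree_finsetProd _ _).trans
        ((Finset.sum_le_sum fun w _ => hq1 w).trans ?_)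
      simpa using hTc
    have hpz : MvPolynomial.eval z p ≠ 0 := by
      simp only [p, map_prod]
      exact Finset.prod_ne_zero_iff.mpr fun w hw => hq3 w (Finset.ne_of_mem_erase hw)
    have hp0 : ∀ w ∈ T, MvPolynomial.eval w p = 0 := by
      intro w hw
      simp only [p, map_prod]
      exact Finset.prod_eq_zero hw (hq2 w)
    have key : ∀ u : Fin m → (Fin k → ℝ), (∀ j, u j ≠ z → u j ∈ T) →
        ∑ j, MvPolynomial.eval (u j) p
          = (Fintype.card {i // u i = z} : ℝ) * MvPolynomial.eval z p := by
      intro u hu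
      have : ∀ j, MvPolynomial.eval (u j) p
          = if u j = z then MvPolynomial.eval z p else 0 := by
        intro j
        split_ifs with hj
        · rw [hj]
        · exact hp0 _ (hu j hj)
      simp only [this]
      rw [← Finset.sum_filter, Finset.sum_const, nsmul_eq_mul, Fintype.card_subtype]
    have e := hp p hpd
    rw [key x fun j hj => Finset.mem_erase.mpr ⟨hj, by simp⟩,
      key y fun j hj => Finset.mem_erase.mpr ⟨hj, by simp⟩] at e
    exact_mod_cast (mul_right_cancel₀ hpz e).symm
  let σ : Fin m ≃ Fin m := Equiv.ofFiberEquiv (f := y) (g := x)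
    fun z => Fintype.equivOfCardEq (hcount z)
  exact ⟨σ, fun i => Equiv.ofFiberEquiv_map _ i⟩

/-- A continuous function on a compact space which is constant on the fibres of a continuous map
into a normal Hausdorff space factors through it. -/
theorem factor_through {X Y : Type*} [TopologicalSpace X] [CompactSpace X]
    [TopologicalSpace Y] [T2Space Y] [NormalSpace Y] (F : X → Y) (hF : Continuous F)
    (G : X → ℝ) (hG : Continuous G) (h : ∀ a b, F a = F b → G a = G b) :
    ∃ ρ : Y → ℝ, Continuous ρ ∧ ∀ a, ρ (F a) = G a := by
  let F' : C(X, Set.range F) := ⟨Set.rangeFactorization F, hF.subtype_mk _⟩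
  have hq : Topology.IsQuotientMap F' :=
    F'.continuous.isClosedMap.isQuotientMap F'.continuous Set.rangeFactorization_surjective
  have hfac : Function.FactorsThrough (⟨G, hG⟩ : C(X, ℝ)) F' := fun a b hab =>
    h a b (congrArg Subtype.val hab)
  obtain ⟨ρ, hρ⟩ := ContinuousMap.exists_restrict_eq (isCompact_range hF).isClosed
    (hq.lift ⟨G, hG⟩ hfac)
  refine ⟨ρ, ρ.continuous, fun a => ?_⟩
  have h1 := DFunLike.congr_fun hρ (F' a)
  have h2 := DFunLike.congr_fun (hq.lift_comp ⟨G, hG⟩ hfac) a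
  exact h1.trans h2


/-- universal approximation of continuous permutation-preserving maps
`g : K^m → ℝ^m` by the architecture `ρ₁(xᵢ, ρ₂(∑_{j ≠ i} φ(xⱼ)))`. -/
theorem equivariant_deepsets_approximation
    (k₁ m : ℕ) (hm : 1 ≤ m)
    (K : Set (Fin k₁ → ℝ)) (hK : IsCompact K)
    (g : (Fin m → (Fin k₁ → ℝ)) → (Fin m → ℝ))
    (hg : ContinuousOn g {x | ∀ i, x i ∈ K})
    (hequiv : ∀ σ : Equiv.Perm (Fin m), ∀ x : Fin m → (Fin k₁ → ℝ),
      (∀ i, x i ∈ K) → ∀ i, g (x ∘ σ) i = g x (σ i))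
    (ε : ℝ) (hε : 0 < ε) :
    ∃ (n : ℕ) (φ : (Fin k₁ → ℝ) → (Fin n → ℝ))
      (ρ₂ : (Fin n → ℝ) → (Fin n → ℝ))
      (ρ₁ : (Fin k₁ → ℝ) × (Fin n → ℝ) → ℝ),
      Continuous φ ∧ Continuous ρ₂ ∧ Continuous ρ₁ ∧
      ∀ i : Fin m, ∀ x : Fin m → (Fin k₁ → ℝ), (∀ i, x i ∈ K) →
        |g x i - ρ₁ (x i, ρ₂ (∑ j ∈ Finset.univ.erase i, φ (x j)))| < ε := by
  classical
  let I := Fin k₁ → Fin (2 * m + 1)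
  let e : I ≃ Fin (Fintype.card I) := Fintype.equivFin I
  let φ : (Fin k₁ → ℝ) → (Fin (Fintype.card I) → ℝ) :=
    fun v t => ∏ c, v c ^ (e.symm t c : ℕ)
  have hφ : Continuous φ := by fun_prop
  have hsum : ∀ (i : Fin m) (x : Fin m → (Fin k₁ → ℝ)),
      (∑ j ∈ Finset.univ.erase i, φ (x j)) + φ (x i) = ∑ j, φ (x j) := fun i x =>
    Finset.sum_erase_add _ _ (Finset.mem_univ i)
  have : CompactSpace K := isCompact_iff_compactSpace.mp hK
  let v : (Fin m → K) → (Fin m → (Fin k₁ → ℝ)) := fun x j => x j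
  have hvK : ∀ x i, v x i ∈ K := fun x i => (x i).2
  have hv : Continuous v := by fun_prop
  let F : Fin m × (Fin m → K) → (Fin k₁ → ℝ) × (Fin (Fintype.card I) → ℝ) :=
    fun p => (v p.2 p.1, ∑ j ∈ Finset.univ.erase p.1, φ (v p.2 j))
  have hF : Continuous F := by
    refine continuous_prod_of_discrete_left.mpr fun i => ?_
    have hvj : ∀ j, Continuous fun x => v x j := fun j => (continuous_apply j).comp hv
    exact (hvj i).prodMk (continuous_finsetSum (Finset.univ.erase i) fun j _ => hφ.comp (hvj j))
  let G : Fin m × (Fin m → K) → ℝ := fun p => g (v p.2) p.1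
  have hG : Continuous G := by
    refine continuous_prod_of_discrete_left.mpr fun i => ?_
    have : Continuous fun x => g (v x) := hg.comp_continuous hv hvK
    exact (continuous_apply i).comp this
  obtain ⟨ρ, hρc, hρ⟩ := factor_through F hF G hG (by
    rintro ⟨i, x⟩ ⟨i', y⟩ hxy
    have h1 : v x i = v y i' := congrArg Prod.fst hxy
    have h2 : ∑ j ∈ Finset.univ.erase i, φ (v x j)
      = ∑ j ∈ Finset.univ.erase i', φ (v y j) := congrArg Prod.snd hxy
    have h3 : ∑ j, φ (v x j) = ∑ j, φ (v y j) := by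
      rw [← hsum i, ← hsum i', h1, h2]
    obtain ⟨σ, hσ⟩ := moments_separate k₁ m (v x) (v y) (by
      intro a
      have := congrFun h3 (e a)
      simpa [φ] using this)
    have h4 : v x ∘ σ = v y := funext hσ
    have h5 := hequiv σ (v x) (hvK x) i'
    have h6 : v x ∘ Equiv.swap i (σ i') = v x := by
      funext j
      have h7 : v x (σ i') = v x i := (hσ i').trans h1.symm
      simp only [Function.comp_apply, Equiv.swap_apply_def]
      split_ifs with ha hb
      · rw [ha, h7]
      · rw [hb, h7]
      · rfl
    have h8 := hequiv (Equiv.swap i (σ i')) (v x) (hvK x) i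
    rw [h6, Equiv.swap_apply_left] at h8
    rw [h4] at h5
    exact h8.trans h5.symm)
  refine ⟨Fintype.card I, φ, id, ρ, hφ, continuous_id, hρc, fun i x hx => ?_⟩
  have := hρ (i, fun j => ⟨x j, hx j⟩)
  simp only [F, G, v] at this
  simp only [id]
  rw [this]
  simpa using hε
end

section
/- Let K ⊂ ℝ be compact, m ≥ 1, and let g : K^m → ℝ^m with components g_1, …, g_m be continuous and permutation preserving: g_i(x_{σ(1)}, …, x_{σ(m)}) = g_{σ(i)}(x_1, …, x_m) for every bijection σ of {1, …, m} and all i. Then there exist n ∈ ℕ and functions φ : ℝ → ℝ^n, ρ₂ : ℝ^n → ℝ^n, and ρ₁ : ℝ × ℝ^n → ℝ such that for every i and every (x_1, …, x_m) ∈ K^m, g_i(x_1, …, x_m) = ρ₁(x_i, ρ₂(∑_{j ≠ i} φ(x_j))) exactly. -/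
/-- If all power sums of order `< 2m` of two real `m`-tuples agree, the tuples agree up to a
permutation. -/
theorem exists_perm_of_power_sums_eq {m : ℕ} (x y : Fin m → ℝ)
    (h : ∀ k < 2 * m, ∑ j, x j ^ k = ∑ j, y j ^ k) :
    ∃ σ : Equiv.Perm (Fin m), y = x ∘ σ := by
  classical
  have hpoly : ∀ P : Polynomial ℝ, P.natDegree < 2 * m →
      ∑ j, P.eval (x j) = ∑ j, P.eval (y j) := by
    intro P hP
    simp only [Polynomial.eval_eq_sum_range' hP]
    rw [Finset.sum_comm, Finset.sum_comm (s := (Finset.univ : Finset (Fin m)))]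
    refine Finset.sum_congr rfl fun k hk => ?_
    rw [← Finset.mul_sum, ← Finset.mul_sum, h k (Finset.mem_range.1 hk)]
  let S : Finset ℝ := Finset.univ.image x ∪ Finset.univ.image y
  have hS : S.card ≤ 2 * m := by
    refine (Finset.card_union_le _ _).trans ?_
    have h1 := Finset.card_image_le (s := Finset.univ) (f := x)
    have h2 := Finset.card_image_le (s := Finset.univ) (f := y)
    simp only [Finset.card_univ, Fintype.card_fin] at h1 h2
    omega
  have hxS : ∀ j, x j ∈ S := fun j => by simp [S]
  have hyS : ∀ j, y j ∈ S := fun j => by simp [S]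
  have hcount : ∀ s, (Finset.univ.filter fun j => x j = s).card
      = (Finset.univ.filter fun j => y j = s).card := by
    intro s
    by_cases hs : s ∈ S
    · let P : Polynomial ℝ := ∏ t ∈ S.erase s, (Polynomial.X - Polynomial.C t)
      have hPd : P.natDegree < 2 * m := by
        have : P.natDegree = (S.erase s).card := by
          simp [P]
        rw [this]
        exact (Finset.card_erase_lt_of_mem hs).trans_le hS
      have hP0 : ∀ t ∈ S, t ≠ s → P.eval t = 0 := by
        intro t ht hts
        simp only [P, Polynomial.eval_prod]
        exact Finset.prod_eq_zero (Finset.mem_erase.2 ⟨hts, ht⟩) (by simp)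
      have hPs : P.eval s ≠ 0 := by
        simp only [P, Polynomial.eval_prod]
        refine Finset.prod_ne_zero_iff.2 fun t ht => ?_
        simpa [sub_eq_zero] using (Finset.mem_erase.1 ht).1.symm
      have key : ∀ z : Fin m → ℝ, (∀ j, z j ∈ S) →
          ∑ j, P.eval (z j) = ((Finset.univ.filter fun j => z j = s).card : ℝ) * P.eval s := by
        intro z hz
        rw [← nsmul_eq_mul, ← Finset.sum_const, Finset.sum_filter]
        refine Finset.sum_congr rfl fun j _ => ?_
        split_ifs with hj
        · rw [hj]
        · exact hP0 _ (hz j) hj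
      have := hpoly P hPd
      rw [key x hxS, key y hyS] at this
      exact_mod_cast mul_right_cancel₀ hPs this
    · have h1 : ∀ j, x j ≠ s := fun j hj => hs (hj ▸ hxS j)
      have h2 : ∀ j, y j ≠ s := fun j hj => hs (hj ▸ hyS j)
      simp [h1, h2]
  have e : ∀ s, Nonempty ({j // y j = s} ≃ {j // x j = s}) := by
    intro s
    refine ⟨Fintype.equivOfCardEq ?_⟩
    rw [Fintype.card_subtype, Fintype.card_subtype, hcount s]
  replace e := fun s => (e s).some
  refine ⟨(Equiv.sigmaFiberEquiv y).symm.trans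
    ((Equiv.sigmaCongrRight e).trans (Equiv.sigmaFiberEquiv x)), ?_⟩
  funext j
  exact ((e (y j)) ⟨j, rfl⟩).2.symm

/-- for one-dimensional inputs (`K ⊂ ℝ` compact), a continuous
permutation-preserving map `g : K^m → ℝ^m` is represented exactly as
`gᵢ(x) = ρ₁(xᵢ, ρ₂(∑_{j ≠ i} φ(xⱼ)))`. -/
theorem equivariant_deepsets_exact_one_dim
    (m : ℕ) (hm : 1 ≤ m)
    (K : Set ℝ) (hK : IsCompact K)
    (g : (Fin m → ℝ) → (Fin m → ℝ))
    (hg : ContinuousOn g {x | ∀ i, x i ∈ K})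
    (hequiv : ∀ σ : Equiv.Perm (Fin m), ∀ x : Fin m → ℝ,
      (∀ i, x i ∈ K) → ∀ i, g (x ∘ σ) i = g x (σ i)) :
    ∃ (n : ℕ) (φ : ℝ → (Fin n → ℝ))
      (ρ₂ : (Fin n → ℝ) → (Fin n → ℝ))
      (ρ₁ : ℝ × (Fin n → ℝ) → ℝ),
      ∀ i : Fin m, ∀ x : Fin m → ℝ, (∀ i, x i ∈ K) →
        g x i = ρ₁ (x i, ρ₂ (∑ j ∈ Finset.univ.erase i, φ (x j))) := by
  classical
  have main : ∀ (i i' : Fin m) (x y : Fin m → ℝ), (∀ j, x j ∈ K) → x i = y i' →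
      (∑ j ∈ Finset.univ.erase i, fun k : Fin (2 * m) => x j ^ (k : ℕ))
        = (∑ j ∈ Finset.univ.erase i', fun k : Fin (2 * m) => y j ^ (k : ℕ)) →
      g x i = g y i' := by
    intro i i' x y hx hxy hsum
    obtain ⟨σ, hσ⟩ := exists_perm_of_power_sums_eq x y (by
      intro k hk
      have := congrFun hsum ⟨k, hk⟩
      simp only [Finset.sum_apply] at this
      rw [← Finset.add_sum_erase _ _ (Finset.mem_univ i),
        ← Finset.add_sum_erase _ (fun j => y j ^ k) (Finset.mem_univ i'), this, hxy])
    have hi : x (σ i') = x i := by rw [hxy, hσ]; rfl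
    have hy : y = x ∘ (σ.trans (Equiv.swap (σ i') i)) := by
      rw [hσ]
      funext j
      simp only [Function.comp_apply, Equiv.trans_apply, Equiv.swap_apply_def]
      split_ifs with h1 h2
      · rw [h1, hi]
      · rw [h2, hi]
      · rfl
    rw [hy, hequiv _ x hx i']
    simp
  refine ⟨2 * m, fun t k => t ^ (k : ℕ), id, fun p =>
    if h : ∃ q : Fin m × (Fin m → ℝ), (∀ j, q.2 j ∈ K) ∧ q.2 q.1 = p.1 ∧
        (∑ j ∈ Finset.univ.erase q.1, fun k : Fin (2 * m) => q.2 j ^ (k : ℕ)) = p.2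
    then g h.choose.2 h.choose.1 else 0, ?_⟩
  intro i x hx
  have h : ∃ q : Fin m × (Fin m → ℝ), (∀ j, q.2 j ∈ K) ∧ q.2 q.1 = x i ∧
        (∑ j ∈ Finset.univ.erase q.1, fun k : Fin (2 * m) => q.2 j ^ (k : ℕ)) =
        ∑ j ∈ Finset.univ.erase i, fun k : Fin (2 * m) => x j ^ (k : ℕ) :=
    ⟨(i, x), hx, rfl, rfl⟩
  simp only [id]
  rw [dif_pos h]
  exact (main _ _ _ _ h.choose_spec.1 h.choose_spec.2.1 h.choose_spec.2.2).symm
end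

section
/- Let N ≥ 2, let Σ ∈ ℝ^{N×N} be symmetric positive definite, and let V ∈ ℝ^{N×N} be upper triangular with strictly positive diagonal entries such that Σ⁻¹ = V Vᵀ. Fix i with 2 ≤ i ≤ N, and write A = Σ_{1:i-1, 1:i-1} (the leading (i−1)×(i−1) principal submatrix of Σ), b = Σ_{1:i-1, i} ∈ ℝ^{i-1}, and c = Σ_{i,i}. Then: (1) the kriging coefficient vector satisfies A⁻¹ b = −V_{1:i-1, i} · V_{i,i}^{-1}, where V_{1:i-1, i} denotes the first i−1 entries of the i-th column of V; and (2) the conditional (Schur-complement) variance satisfies c − bᵀ A⁻¹ b = V_{i,i}^{-2}. -/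
open Matrix

lemma vk_sum_split {N : ℕ} (i : Fin N) (f : Fin N → ℝ) (hf : ∀ j, i < j → f j = 0) :
    ∑ j, f j = ∑ a : Fin (i : ℕ), f (Fin.castLE i.isLt.le a) + f i := by
  let g : ℕ → ℝ := fun n => if h : n < N then f ⟨n, h⟩ else 0
  have h1 : ∑ j, f j = ∑ n ∈ Finset.range N, g n := by
    rw [Finset.sum_range]
    exact Finset.sum_congr rfl fun j _ => by simp [g]
  have h2 : ∑ a : Fin (i : ℕ), f (Fin.castLE i.isLt.le a) = ∑ n ∈ Finset.range i, g n := by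
    rw [Finset.sum_range]
    refine Finset.sum_congr rfl fun a _ => ?_
    have : (a : ℕ) < N := a.isLt.trans i.isLt
    simp only [g, this, dif_pos]
    rfl
  have h3 : f i = g i := by simp [g]
  rw [h1, h2, h3, ← Finset.sum_range_succ]
  symm
  apply Finset.sum_subset
  · intro n hn
    have := i.isLt
    simp only [Finset.mem_range] at *
    omega
  · intro n hn hn'
    simp only [Finset.mem_range] at hn hn'
    simp only [g, hn, dif_pos]
    apply hf
    rw [Fin.lt_def]
    simp only
    omega

/-- under the factorization `Σ⁻¹ = V Vᵀ` with `V` upper triangular and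
positive diagonal, the kriging coefficients satisfy `A⁻¹ b = -V_{1:i-1,i} V_{i,i}⁻¹`
and the conditional (Schur-complement) variance satisfies
`c - bᵀ A⁻¹ b = V_{i,i}⁻²`. -/
theorem vecchia_kriging_parameterization
    (N : ℕ) (hN : 2 ≤ N)
    (C V : Matrix (Fin N) (Fin N) ℝ)
    (hC : C.PosDef)
    (hVtri : V.BlockTriangular id)
    (hVdiag : ∀ j, 0 < V j j)
    (hfac : C⁻¹ = V * Vᵀ)
    (i : Fin N) (hi : 1 ≤ (i : ℕ)) :
    ((Matrix.of fun a b : Fin (i : ℕ) =>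
        C (Fin.castLE i.isLt.le a) (Fin.castLE i.isLt.le b))⁻¹
        *ᵥ fun a : Fin (i : ℕ) => C (Fin.castLE i.isLt.le a) i)
      = (fun a : Fin (i : ℕ) => -(V (Fin.castLE i.isLt.le a) i) * (V i i)⁻¹)
    ∧ C i i - (fun a : Fin (i : ℕ) => C (Fin.castLE i.isLt.le a) i) ⬝ᵥ
        ((Matrix.of fun a b : Fin (i : ℕ) =>
          C (Fin.castLE i.isLt.le a) (Fin.castLE i.isLt.le b))⁻¹
          *ᵥ fun a : Fin (i : ℕ) => C (Fin.castLE i.isLt.le a) i)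
      = ((V i i)⁻¹) ^ 2 := by
  have hCu : IsUnit C.det := hC.det_pos.ne'.isUnit
  have hone : C * V * Vᵀ = 1 := by
    rw [Matrix.mul_assoc, ← hfac, Matrix.mul_nonsing_inv _ hCu]
  have hVV : V * (C * V)ᵀ = 1 := by
    have := congrArg Matrix.transpose hone
    simpa [Matrix.transpose_mul] using this
  have hinv : V⁻¹ = (C * V)ᵀ := Matrix.inv_eq_right_inv hVV
  have : Invertible V := Matrix.invertibleOfIsUnitDet V (Matrix.isUnit_det_of_right_inverse hVV)
  have htri : ((C * V)ᵀ).BlockTriangular id := by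
    rw [← hinv]
    exact Matrix.blockTriangular_inv_of_blockTriangular hVtri
  have hVi : V i i ≠ 0 := (hVdiag i).ne'
  have hlow : ∀ k, k < i → (C * V) k i = 0 := fun k hk => htri (i := i) (j := k) hk
  have hdiag : V i i * (C * V) i i = 1 := by
    have h := congrFun (congrFun hVV i) i
    rw [Matrix.mul_apply, Finset.sum_eq_single i] at h
    · simpa using h
    · intro k _ hk
      rcases lt_or_gt_of_ne hk with h' | h'
      · rw [hVtri (i := i) (j := k) h', zero_mul]
      · rw [htri (i := k) (j := i) h', mul_zero]
    · simp
  have hsplit : ∀ k, (C * V) k i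
      = ∑ a : Fin (i : ℕ), C k (Fin.castLE i.isLt.le a) * V (Fin.castLE i.isLt.le a) i
        + C k i * V i i := by
    intro k
    rw [Matrix.mul_apply]
    exact vk_sum_split i (fun j => C k j * V j i) fun j hj => by
      simp only [hVtri (i := j) (j := i) hj, mul_zero]
  have hsymm : ∀ a b, C a b = C b a := fun a b => by
    simpa using hC.isHermitian.apply b a
  have hinj : Function.Injective (Fin.castLE i.isLt.le) := Fin.castLE_injective _
  have hA : (Matrix.of fun a b : Fin (i : ℕ) =>
        C (Fin.castLE i.isLt.le a) (Fin.castLE i.isLt.le b)).PosDef :=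
    hC.submatrix hinj
  have key : ((Matrix.of fun a b : Fin (i : ℕ) =>
        C (Fin.castLE i.isLt.le a) (Fin.castLE i.isLt.le b))⁻¹
        *ᵥ fun a : Fin (i : ℕ) => C (Fin.castLE i.isLt.le a) i)
      = (fun a : Fin (i : ℕ) => -(V (Fin.castLE i.isLt.le a) i) * (V i i)⁻¹) := by
    have hb : (fun a : Fin (i : ℕ) => C (Fin.castLE i.isLt.le a) i)
        = (Matrix.of fun a b : Fin (i : ℕ) =>
          C (Fin.castLE i.isLt.le a) (Fin.castLE i.isLt.le b)) *ᵥ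
          (fun a : Fin (i : ℕ) => -(V (Fin.castLE i.isLt.le a) i) * (V i i)⁻¹) := by
      funext a
      have h := hsplit (Fin.castLE i.isLt.le a)
      rw [hlow _ (by rw [Fin.lt_def]; exact a.isLt)] at h
      simp only [Matrix.mulVec, dotProduct, Matrix.of_apply, ← mul_assoc, mul_neg]
      rw [← Finset.sum_mul, Finset.sum_neg_distrib]
      field_simp
      linarith
    rw [hb, Matrix.mulVec_mulVec, Matrix.nonsing_inv_mul _ hA.det_pos.ne'.isUnit,
      Matrix.one_mulVec]
  refine ⟨key, ?_⟩
  rw [key]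
  have h := hsplit i
  have hw : (C * V) i i = (V i i)⁻¹ := by
    field_simp
    linarith
  rw [hw] at h
  simp only [dotProduct, ← mul_assoc, mul_neg]
  rw [← Finset.sum_mul, Finset.sum_neg_distrib]
  simp only [hsymm _ i]
  have h' : ∑ a : Fin (i : ℕ), C i (Fin.castLE i.isLt.le a) * V (Fin.castLE i.isLt.le a) i
      = (V i i)⁻¹ - C i i * V i i := by linarith
  rw [h']
  field_simp
  ring
end
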